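/- Let d ≥ 2, let E ⊆ ℝ^d be Lebesgue-measurable, let 0 < ρ' < ρ(E) where ρ(E) is the upper Banach density of E, let 0 < S ≤ D, and let m be a positive integer. Then there exists s_0 > 0 (depending only on E, S, D, m) such that for every choice of numbers r_1, …, r_m ∈ [S, D] and every s ≥ s_0 there exists x ∈ E such that 𝓗^{d−1}(E ∩ S_{r_i s}(x)) > ρ' · 𝓗^{d−1}(S_{r_i s}) for all 1 ≤ i ≤ m, where S_r(x) denotes the sphere of centre x and radius r. -/

import Mathlib

open MeasureTheory Filter

/-- The upper Banach density of a set `E ⊆ ℝ^d`. -/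
noncomputable def upperBanachDensity (d : ℕ) (E : Set (EuclideanSpace ℝ (Fin d))) : ENNReal :=
  Filter.limsup (fun r : ℝ => ⨆ x : EuclideanSpace ℝ (Fin d),
    volume (E ∩ Metric.closedBall x r) / volume (Metric.closedBall x r)) Filter.atTop

section HausdorffSphere

open scoped RealInnerProductSpace Topology ENNReal Pointwise

variable {V : Type*} [NormedAddCommGroup V] [InnerProductSpace ℝ V] [FiniteDimensional ℝ V]
  [MeasurableSpace V] [BorelSpace V]

open Module in
lemma hausdorffMeasure_sphere_inter_halfspace_lt_top {n : ℕ} (hn : finrank ℝ V = n + 1)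
    {v : V} (hv : ‖v‖ = 1) :
    μH[(n : ℝ)] (Metric.sphere (0 : V) 1 ∩ {y | ⟪v, y⟫ ≤ 0}) < ∞ := by
  have : Fact (finrank ℝ V = n + 1) := ⟨hn⟩
  have hW : finrank ℝ (ℝ ∙ v)ᗮ = n :=
    Submodule.finrank_orthogonal_span_singleton (n := n) (by intro h; simp [h] at hv)
  have hball : μH[(n : ℝ)] (Metric.closedBall (0 : (ℝ ∙ v)ᗮ) 2) < ∞ := by
    rw [← hW]
    exact (isCompact_closedBall _ _).measure_lt_top
  have hcd : ContDiff ℝ 1 (fun w : (ℝ ∙ v)ᗮ => stereoInvFunAux v (w : V)) :=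
    contDiff_stereoInvFunAux.comp (ℝ ∙ v)ᗮ.subtypeL.contDiff
  obtain ⟨K, hK⟩ := hcd.locallyLipschitz.locallyLipschitzOn.exists_lipschitzOnWith_of_compact
    (isCompact_closedBall (0 : (ℝ ∙ v)ᗮ) 2)
  have hsub : Metric.sphere (0 : V) 1 ∩ {y | ⟪v, y⟫ ≤ 0} ⊆
      (fun w : (ℝ ∙ v)ᗮ => stereoInvFunAux v (w : V)) '' Metric.closedBall 0 2 := by
    rintro y ⟨hy, hvy⟩
    have hne : y ≠ v := by
      rintro rfl
      simp only [Set.mem_ofPred_eq, real_inner_self_eq_norm_sq, hv] at hvy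
      norm_num at hvy
    refine ⟨stereoToFun v y, ?_, congrArg Subtype.val (stereo_left_inv hv (x := ⟨y, hy⟩) hne)⟩
    rw [mem_closedBall_zero_iff, stereoToFun_apply, norm_smul]
    have h1 : ‖(ℝ ∙ v)ᗮ.orthogonalProjectionOnto y‖ ≤ 1 :=
      (Submodule.norm_orthogonalProjectionOnto_apply_le _ y).trans (by simpa using hy.le)
    have h2 : ‖2 / (1 - ⟪v, y⟫)‖ ≤ 2 := by
      have : (1 : ℝ) ≤ 1 - ⟪v, y⟫ := by linarith [hvy.out]
      rw [Real.norm_of_nonneg (by positivity)]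
      exact div_le_self (by norm_num) this
    simpa using mul_le_mul h2 h1 (norm_nonneg _) zero_le_two
  refine (measure_mono hsub).trans_lt ((hK.hausdorffMeasure_image_le (by positivity)).trans_lt ?_)
  exact ENNReal.mul_lt_top (by simp) hball

open Module in
lemma hausdorffMeasure_sphere_lt_top {n : ℕ} (hn : finrank ℝ V = n + 1) :
    μH[(n : ℝ)] (Metric.sphere (0 : V) 1) < ∞ := by
  have : Nontrivial V := nontrivial_of_finrank_pos (R := ℝ) (by omega)
  obtain ⟨v, hv⟩ := exists_norm_eq V zero_le_one
  have hv' : ‖-v‖ = 1 := by simpa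
  refine (measure_mono (fun y hy => ?_)).trans_lt ((measure_union_le _ _).trans_lt
    (ENNReal.add_lt_top.2 ⟨hausdorffMeasure_sphere_inter_halfspace_lt_top hn hv,
      hausdorffMeasure_sphere_inter_halfspace_lt_top hn hv'⟩))
  rcases le_total ⟪v, y⟫ 0 with h | h
  · exact Or.inl ⟨hy, h⟩
  · exact Or.inr ⟨hy, by simpa using h⟩

open Module in
lemma hausdorffMeasure_sphere_pos {n : ℕ} (hn : finrank ℝ V = n + 1) :
    0 < μH[(n : ℝ)] (Metric.sphere (0 : V) 1) := by
  have : Nontrivial V := nontrivial_of_finrank_pos (R := ℝ) (by omega)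
  obtain ⟨v, hv⟩ := exists_norm_eq V zero_le_one
  have : Fact (finrank ℝ V = n + 1) := ⟨hn⟩
  have hW : finrank ℝ (ℝ ∙ v)ᗮ = n :=
    Submodule.finrank_orthogonal_span_singleton (n := n) (by intro h; simp [h] at hv)
  have hball : 0 < μH[(n : ℝ)] (Metric.ball (0 : (ℝ ∙ v)ᗮ) 1) := by
    rw [← hW]
    exact Metric.measure_ball_pos _ _ one_pos
  refine hball.trans_le ?_
  have hlip : LipschitzWith 1 (ℝ ∙ v)ᗮ.orthogonalProjectionOnto :=
    (ℝ ∙ v)ᗮ.orthogonalProjectionOnto.lipschitz.weaken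
      (Submodule.orthogonalProjectionOnto_norm_le _)
  have h := hlip.hausdorffMeasure_image_le (d := n) (by positivity) (Metric.sphere (0 : V) 1)
  simp only [ENNReal.coe_one, ENNReal.one_rpow, one_mul] at h
  refine (measure_mono fun w hw => ?_).trans h
  have hw1 : ‖w‖ < 1 := by simpa using hw
  have horth : ⟪(w : V), v⟫ = 0 := Submodule.mem_orthogonal_singleton_iff_inner_left.1 w.2
  refine ⟨(w : V) + √(1 - ‖w‖ ^ 2) • v, ?_, ?_⟩
  · rw [mem_sphere_zero_iff_norm]
    have hsq : ‖(w : V) + √(1 - ‖w‖ ^ 2) • v‖ ^ 2 = 1 := by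
      rw [norm_add_sq_real, inner_smul_right, horth, norm_smul, hv, Real.norm_of_nonneg (by positivity),
        mul_one, Real.sq_sqrt (by nlinarith [norm_nonneg w])]
      simp
    nlinarith [norm_nonneg ((w : V) + √(1 - ‖w‖ ^ 2) • v)]
  · rw [map_add, map_smul, Submodule.orthogonalProjectionOnto_mem_subspace_eq_self]
    rw [Submodule.orthogonalProjectionOnto_orthogonal_apply_eq_zero (Submodule.mem_span_singleton_self v)]
    simp

omit [FiniteDimensional ℝ V] in
/-- Scaling and translating a piece of a sphere to the unit sphere. -/
lemma hausdorffMeasure_inter_sphere {s : ℝ} (hs : 0 ≤ s) (E : Set V) (x : V) {t : ℝ} (ht : 0 < t) :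
    μH[s] (E ∩ Metric.sphere x t) =
      ENNReal.ofReal t ^ s * μH[s] (Metric.sphere (0 : V) 1 ∩ {y | x + t • y ∈ E}) := by
  have himg : E ∩ Metric.sphere x t =
      IsometryEquiv.addLeft x '' (t • (Metric.sphere (0 : V) 1 ∩ {y | x + t • y ∈ E})) := by
    ext z
    simp only [Set.mem_inter_iff, Metric.mem_sphere, dist_eq_norm, Set.mem_image,
      Set.mem_smul_set, sub_zero, Set.mem_ofPred_eq, IsometryEquiv.addLeft_apply]
    constructor
    · rintro ⟨hz, hzt⟩
      have : t • t⁻¹ • (z - x) = z - x := smul_inv_smul₀ ht.ne' _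
      refine ⟨z - x, ⟨t⁻¹ • (z - x), ⟨?_, ?_⟩, this⟩, by simp⟩
      · rw [norm_smul, hzt, norm_inv, Real.norm_of_nonneg ht.le, inv_mul_cancel₀ ht.ne']
      · rw [this]; simpa using hz
    · rintro ⟨_, ⟨y, ⟨hy, hyE⟩, rfl⟩, rfl⟩
      refine ⟨hyE, ?_⟩
      rw [add_sub_cancel_left, norm_smul, hy, Real.norm_of_nonneg ht.le, mul_one]
  rw [himg, IsometryEquiv.hausdorffMeasure_image, Measure.hausdorffMeasure_smul₀ hs ht.ne',
    ENNReal.smul_def, smul_eq_mul, ENNReal.coe_rpow_of_nonneg _ hs]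
  congr 3
  exact (Real.toNNReal_eq_nnnorm_of_nonneg ht.le).symm

omit [FiniteDimensional ℝ V] in
lemma map_hausdorffMeasure_restrict_sphere (s : ℝ) (g : V ≃ₗᵢ[ℝ] V) :
    Measure.map g ((μH[s] : Measure V).restrict (Metric.sphere 0 1)) =
      (μH[s] : Measure V).restrict (Metric.sphere 0 1) := by
  have h := (g.toIsometryEquiv.measurePreserving_hausdorffMeasure s).restrict_preimage
    (s := Metric.sphere (0 : V) 1) Metric.isClosed_sphere.measurableSet
  have h2 : g.toIsometryEquiv ⁻¹' Metric.sphere (0 : V) 1 = Metric.sphere 0 1 := by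
    ext y
    simp
  rw [h2] at h
  exact h.map_eq

end HausdorffSphere

section RotationInvariant

open scoped RealInnerProductSpace Topology ENNReal Pointwise

variable {V : Type*} [NormedAddCommGroup V] [InnerProductSpace ℝ V] [FiniteDimensional ℝ V]
  [MeasurableSpace V] [BorelSpace V]

omit [MeasurableSpace V] [BorelSpace V] in
lemma isCompact_unitary_continuousLinearMap :
    IsCompact ((unitary (V →L[ℝ] V) : Submonoid _) : Set (V →L[ℝ] V)) := by
  refine (isCompact_closedBall (0 : V →L[ℝ] V) 1).of_isClosed_subset isClosed_unitary ?_
  intro u hu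
  rw [mem_closedBall_zero_iff]
  refine ContinuousLinearMap.opNorm_le_bound _ zero_le_one fun x => ?_
  exact (((Unitary.linearIsometryEquiv ⟨u, hu⟩).norm_map x).trans (one_mul _).symm).le

omit [FiniteDimensional ℝ V] [MeasurableSpace V] [BorelSpace V] in
lemma exists_linearIsometryEquiv_apply_eq {v w : V} (h : ‖v‖ = ‖w‖) : ∃ g : V ≃ₗᵢ[ℝ] V, g v = w :=
  ⟨_, Submodule.reflection_sub h⟩

/-- An average over the orthogonal group of the indicator of a null set: a function depending
only on the norm, vanishing almost everywhere, that computes rotation invariant measures. -/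
lemma exists_radial_average {N : Set V} (hN : MeasurableSet N) (hN0 : volume N = 0) :
    ∃ F : V → ℝ≥0∞, Measurable F ∧ (∀ v w, ‖v‖ = ‖w‖ → F v = F w) ∧ (∀ᵐ z, F z = 0) ∧
      ∀ μ : Measure V, IsFiniteMeasure μ → (∀ g : V ≃ₗᵢ[ℝ] V, μ.map g = μ) →
        μ N = ∫⁻ z, F z ∂μ := by
  let G := unitary (V →L[ℝ] V)
  have : CompactSpace G := isCompact_iff_compactSpace.1 isCompact_unitary_continuousLinearMap
  have : SecondCountableTopology (V →L[ℝ] V) := inferInstance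
  have : SecondCountableTopology G := inferInstanceAs (SecondCountableTopology (Subtype _))
  let _ : MeasurableSpace G := borel G
  have : BorelSpace G := ⟨rfl⟩
  let κ₀ : Measure G := Measure.haar
  let κ : Measure G := (κ₀ Set.univ)⁻¹ • κ₀.inv
  have hκ₀ : κ₀ Set.univ ≠ 0 := NeZero.ne _
  have hκ₀' : κ₀ Set.univ ≠ ∞ := measure_ne_top _ _
  have hκ1 : IsProbabilityMeasure κ := ⟨by
    have hinv : κ₀.inv Set.univ = κ₀ Set.univ := by
      rw [Measure.inv, Measure.map_apply measurable_inv MeasurableSet.univ, Set.preimage_univ]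
    rw [Measure.smul_apply, hinv, smul_eq_mul, ENNReal.inv_mul_cancel hκ₀ hκ₀']⟩
  have hκr : κ.IsMulRightInvariant := inferInstance
  have hact : Measurable (fun p : G × V => (p.1 : V →L[ℝ] V) p.2) := by
    have : Continuous (fun p : G × V => (p.1 : V →L[ℝ] V) p.2) := by fun_prop
    exact this.measurable
  have hA : MeasurableSet ((fun p : G × V => (p.1 : V →L[ℝ] V) p.2) ⁻¹' N) := hact hN
  have hF : Measurable fun z => κ {g | (g : V →L[ℝ] V) z ∈ N} :=
    measurable_measure_prodMk_right hA
  have hinv_prod : ∀ μ : Measure V, SFinite μ → (∀ g : V ≃ₗᵢ[ℝ] V, μ (g ⁻¹' N) = μ N) →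
      ∫⁻ z, κ {g | (g : V →L[ℝ] V) z ∈ N} ∂μ = μ N := by
    intro μ _ hμ
    have h1 := Measure.prod_apply_symm (μ := κ) (ν := μ) hA
    rw [Measure.prod_apply hA] at h1
    refine h1.symm.trans ?_
    have h2 : ∀ g : G, μ (Prod.mk g ⁻¹' ((fun p : G × V => (p.1 : V →L[ℝ] V) p.2) ⁻¹' N)) = μ N :=
      fun g => hμ (Unitary.linearIsometryEquiv g)
    simp [h2]
  refine ⟨_, hF, ?_, ?_, ?_⟩
  · intro v w h
    obtain ⟨e, rfl⟩ := exists_linearIsometryEquiv_apply_eq h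
    let u : G := Unitary.linearIsometryEquiv.symm e
    exact (measure_preimage_mul_right κ u {g : G | (g : V →L[ℝ] V) v ∈ N}).symm
  · refine (lintegral_eq_zero_iff hF).1 ?_
    rw [hinv_prod volume inferInstance, hN0]
    exact fun g => g.measurePreserving.measure_preimage hN.nullMeasurableSet
  · intro μ _ hμ
    refine (hinv_prod μ inferInstance fun g => ?_).symm
    rw [← Measure.map_apply g.continuous.measurable hN, hμ g]

/-- A set of radii is Lebesgue null if the corresponding union of spheres is. -/
lemma volume_radii_eq_zero [Nontrivial V] {M : Set ℝ} (hM : MeasurableSet M)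
    (h : volume {z : V | ‖z‖ ∈ M} = 0) : volume (M ∩ Set.Ioi 0) = 0 := by
  have hmp := Measure.measurePreserving_homeomorphUnitSphereProd (volume : Measure V)
  have hM' : MeasurableSet ((↑) ⁻¹' M : Set (Set.Ioi (0 : ℝ))) := measurable_subtype_coe hM
  have h1 := hmp.measure_preimage (MeasurableSet.univ.prod hM').nullMeasurableSet
  rw [Measure.prod_prod, comap_subtype_coe_apply (measurableSet_singleton _).compl] at h1
  have h2 : volume ((↑) '' ((homeomorphUnitSphereProd V) ⁻¹' (Set.univ ×ˢ
      ((↑) ⁻¹' M : Set (Set.Ioi (0 : ℝ))))) : Set V) = 0 := by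
    refine measure_mono_null ?_ h
    rintro _ ⟨z, hz, rfl⟩
    simpa using hz
  rw [h2] at h1
  have h3 := (mul_eq_zero.1 h1.symm).resolve_left
    (Measure.measure_univ_ne_zero.2 (Measure.toSphere_ne_zero (volume : Measure V)))
  rw [Measure.volumeIoiPow, withDensity_apply_eq_zero (by fun_prop)] at h3
  have h4 : {r : Set.Ioi (0 : ℝ) | ENNReal.ofReal (r.1 ^ (Module.finrank ℝ V - 1)) ≠ 0} = Set.univ := by
    ext r
    simpa using pow_pos r.2.out _
  rw [h4, Set.univ_inter, comap_subtype_coe_apply measurableSet_Ioi] at h3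
  rwa [Subtype.image_preimage_coe, Set.inter_comm] at h3

/-- The function `a ↦ a / √(a ^ 2 + b ^ 2)`, composed with `w ↦ √(2 - 2 * w)`, is inverted by an
explicit differentiable function. -/
lemma chord_left_inv {b u τ : ℝ} (hb : 0 < b) (hτ : τ ^ 2 = 2 - 2 * (u / √(u ^ 2 + b ^ 2))) :
    b * (1 - τ ^ 2 / 2) / √(1 - (1 - τ ^ 2 / 2) ^ 2) = u := by
  have hs : 0 < u ^ 2 + b ^ 2 := by positivity
  have hr : 0 < √(u ^ 2 + b ^ 2) := Real.sqrt_pos.2 hs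
  have hr2 : √(u ^ 2 + b ^ 2) ^ 2 = u ^ 2 + b ^ 2 := Real.sq_sqrt hs.le
  have hw : 1 - τ ^ 2 / 2 = u / √(u ^ 2 + b ^ 2) := by rw [hτ]; ring
  have h1 : 1 - (u / √(u ^ 2 + b ^ 2)) ^ 2 = (b / √(u ^ 2 + b ^ 2)) ^ 2 := by
    field_simp
    rw [hr2]; ring
  rw [hw, h1, Real.sqrt_sq (by positivity)]
  field_simp

lemma volume_chord_preimage_eq_zero {M : Set ℝ} (hM : volume M = 0) {b c : ℝ} (hb : 0 < b)
    {θ : ℝ → ℝ} (hθ : ∀ a, θ a ^ 2 = 2 - 2 * ((c + a) / √((c + a) ^ 2 + b ^ 2))) :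
    volume (θ ⁻¹' M) = 0 := by
  let ψ : ℝ → ℝ := fun τ => b * (1 - τ ^ 2 / 2) / √(1 - (1 - τ ^ 2 / 2) ^ 2) - c
  let U : Set ℝ := {τ | 0 < 1 - (1 - τ ^ 2 / 2) ^ 2}
  have hψ : DifferentiableOn ℝ ψ (M ∩ U) := by
    intro τ hτ
    have hτ' : 0 < 1 - (1 - τ ^ 2 / 2) ^ 2 := hτ.2
    have h1 : DifferentiableAt ℝ (fun τ : ℝ => √(1 - (1 - τ ^ 2 / 2) ^ 2)) τ :=
      DifferentiableAt.sqrt (by fun_prop) hτ'.ne'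
    have h2 : DifferentiableAt ℝ (fun τ : ℝ => b * (1 - τ ^ 2 / 2)) τ := by fun_prop
    exact ((h2.div h1 (Real.sqrt_pos.2 hτ').ne').sub_const c).differentiableWithinAt
  refine measure_mono_null ?_ (addHaar_image_eq_zero_of_differentiableOn_of_addHaar_eq_zero volume
    hψ (measure_mono_null Set.inter_subset_left hM))
  intro a ha
  refine ⟨θ a, ⟨ha, ?_⟩, ?_⟩
  · have hs : 0 < (c + a) ^ 2 + b ^ 2 := by positivity
    have hr : 0 < √((c + a) ^ 2 + b ^ 2) := Real.sqrt_pos.2 hs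
    have hr2 : √((c + a) ^ 2 + b ^ 2) ^ 2 = (c + a) ^ 2 + b ^ 2 := Real.sq_sqrt hs.le
    have h1 : 1 - (1 - θ a ^ 2 / 2) ^ 2 = (b / √((c + a) ^ 2 + b ^ 2)) ^ 2 := by
      rw [hθ a]
      field_simp
      rw [hr2]; ring
    change 0 < 1 - (1 - θ a ^ 2 / 2) ^ 2
    rw [h1]; positivity
  · change _ - c = a
    rw [chord_left_inv hb (hθ a)]; ring

lemma volume_chord_length_mem_eq_zero (hd : 2 ≤ Module.finrank ℝ V) {M : Set ℝ}
    (hM : MeasurableSet M) (hM0 : volume M = 0) {x : V} (hx : ‖x‖ = 1) :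
    ∀ᵐ z : V, ‖x - ‖z‖⁻¹ • z‖ ∉ M := by
  have hmeas : Measurable fun z : V => ‖x - ‖z‖⁻¹ • z‖ := by fun_prop
  have hspan : ∀ᵐ z : V, z ∉ (ℝ ∙ x) := by
    refine measure_eq_zero_iff_ae_notMem.1 (Measure.addHaar_submodule volume (ℝ ∙ x) fun h => ?_)
    have h1 := finrank_span_singleton (K := ℝ) (v := x) (by intro h; simp [h] at hx)
    rw [h, finrank_top] at h1
    omega
  have hs : MeasurableSet ({z : V | z ∈ (ℝ ∙ x)} ∪ {z | ‖x - ‖z‖⁻¹ • z‖ ∈ M}ᶜ) :=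
    (ℝ ∙ x).closed_of_finiteDimensional.measurableSet.union (hmeas hM).compl
  have key := ae_mem_of_ae_add_linearMap_mem (LinearMap.toSpanSingleton ℝ V x) volume volume hs
    fun z => ?_
  · filter_upwards [hspan, key] with z hz hz'
    exact hz'.resolve_left hz
  by_cases hz : z ∈ (ℝ ∙ x)
  · refine Eventually.of_forall fun a => Or.inl ?_
    exact add_mem hz (Submodule.smul_mem _ _ (Submodule.mem_span_singleton_self x))
  set c : ℝ := ⟪x, z⟫ with hc
  set p : V := z - c • x with hp
  have hpx : ⟪x, p⟫ = 0 := by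
    rw [hp, inner_sub_right, inner_smul_right, real_inner_self_eq_norm_sq, hx]; simp [hc]
  have hp0 : 0 < ‖p‖ := by
    rw [norm_pos_iff]
    intro h
    exact hz (Submodule.mem_span_singleton.2 ⟨c, (sub_eq_zero.1 h).symm⟩)
  have hza : ∀ a : ℝ, z + a • x = p + (c + a) • x := fun a => by rw [hp, add_smul]; abel
  have hnorm : ∀ a : ℝ, ‖z + a • x‖ = √((c + a) ^ 2 + ‖p‖ ^ 2) := fun a => by
    rw [hza, eq_comm, Real.sqrt_eq_iff_mul_self_eq (by positivity) (norm_nonneg _), ← sq,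
      norm_add_sq_real, inner_smul_right, real_inner_comm, hpx, norm_smul, hx]
    simp [add_comm]
  have hnull := volume_chord_preimage_eq_zero hM0 hp0 (c := c)
    (θ := fun a => ‖x - ‖z + a • x‖⁻¹ • (z + a • x)‖) fun a => ?_
  · filter_upwards [measure_eq_zero_iff_ae_notMem.1 hnull] with a ha
    exact Or.inr ha
  · have hpos : 0 < √((c + a) ^ 2 + ‖p‖ ^ 2) := Real.sqrt_pos.2 (by positivity)
    have hin : ⟪x, z + a • x⟫ = c + a := by
      rw [hza, inner_add_right, hpx, inner_smul_right, real_inner_self_eq_norm_sq, hx]; ring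
    have hone : ‖‖z + a • x‖⁻¹ • (z + a • x)‖ = 1 := by
      rw [norm_smul, norm_inv, norm_norm, hnorm, inv_mul_cancel₀ hpos.ne']
    rw [norm_sub_sq_real, inner_smul_right, hin, hone, hx, hnorm]
    ring

/-- The difference of two independent points of a rotation invariant measure on the unit sphere
has an absolutely continuous distribution. -/
theorem map_sub_prod_absolutelyContinuous (hd : 2 ≤ Module.finrank ℝ V) {σ : Measure V}
    [IsFiniteMeasure σ] (hσ : ∀ᵐ x ∂σ, ‖x‖ = 1) (hrot : ∀ g : V ≃ₗᵢ[ℝ] V, σ.map g = σ) :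
    (σ.prod σ).map (fun p => p.1 - p.2) ≪ (volume : Measure V) := by
  have : Nontrivial V := Module.nontrivial_of_finrank_pos (R := ℝ) (by omega)
  refine Measure.AbsolutelyContinuous.mk fun N hN hN0 => ?_
  obtain ⟨F, hF, hFr, hF0, hFμ⟩ := exists_radial_average hN hN0
  have hsub : Measurable fun p : V × V => p.1 - p.2 := by fun_prop
  rw [hFμ _ inferInstance, lintegral_map hF hsub]
  swap
  · intro g
    rw [Measure.map_map g.continuous.measurable hsub]
    have h1 : (g ∘ fun p : V × V => p.1 - p.2) = (fun p => p.1 - p.2) ∘ Prod.map g g := by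
      ext p
      simp
    rw [h1, ← Measure.map_map hsub (g.continuous.measurable.prodMap g.continuous.measurable),
      ← Measure.map_prod_map _ _ g.continuous.measurable g.continuous.measurable, hrot g]
  obtain ⟨e, he⟩ := exists_norm_eq V zero_le_one
  -- the radii on which the average does not vanish
  let f : ℝ → ℝ≥0∞ := fun τ => F (τ • e)
  have hf : Measurable f := hF.comp (by fun_prop)
  have hfF : ∀ z, F z = f ‖z‖ := fun z => hFr _ _ (by simp [norm_smul, he])
  have hM : MeasurableSet {τ | f τ ≠ 0} := (hf (measurableSet_singleton 0)).compl
  have hM0 : volume ({τ | f τ ≠ 0} ∩ Set.Ioi 0) = 0 := by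
    refine volume_radii_eq_zero (V := V) hM ?_
    rw [measure_eq_zero_iff_ae_notMem]
    filter_upwards [hF0] with z hz
    simpa [← hfF] using hz
  have hchord : ∀ x : V, ‖x‖ = 1 → ∀ᵐ z : V, F (x - ‖z‖⁻¹ • z) = 0 := by
    intro x hx
    have hone : ∀ᵐ z : V, ‖x - ‖z‖⁻¹ • z‖ ≠ 0 := by
      simpa using volume_chord_length_mem_eq_zero hd (measurableSet_singleton 0) (by simp) hx
    filter_upwards [volume_chord_length_mem_eq_zero hd (hM.inter measurableSet_Ioi) hM0 hx, hone]
      with z hz hz'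
    by_contra h
    rw [hfF] at h
    exact hz ⟨h, (norm_nonneg _).lt_of_ne' hz'⟩
  have hmF : Measurable fun p : V × V => F (p.1 - p.2) := hF.comp hsub
  have hconst : ∀ y y' : V, ‖y‖ = ‖y'‖ → ∫⁻ x, F (x - y) ∂σ = ∫⁻ x, F (x - y') ∂σ := by
    intro y y' h
    obtain ⟨g, rfl⟩ := exists_linearIsometryEquiv_apply_eq h
    conv_rhs => rw [← hrot g]
    rw [lintegral_map (by fun_prop) g.continuous.measurable]
    refine lintegral_congr fun x => hFr _ _ ?_
    rw [← map_sub, g.norm_map]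
  have hzero : ∀ y : V, ‖y‖ = 1 → ∫⁻ x, F (x - y) ∂σ = 0 := by
    have hm : Measurable fun p : V × V => F (p.1 - ‖p.2‖⁻¹ • p.2) := hF.comp (by fun_prop)
    have h1 : ∫⁻ z : V, ∫⁻ x, F (x - ‖z‖⁻¹ • z) ∂σ = 0 := by
      rw [lintegral_lintegral_swap (by exact (hm.comp measurable_swap).aemeasurable),
        lintegral_eq_zero_iff (hm.lintegral_prod_right')]
      filter_upwards [hσ] with x hx
      exact (lintegral_eq_zero_iff (hm.comp measurable_prodMk_left)).2 (hchord x hx)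
    rw [lintegral_eq_zero_iff hm.lintegral_prod_left'] at h1
    have h2 : ∀ᵐ z : V, z ≠ 0 := by simp [ae_iff]
    obtain ⟨z, hz, hz0⟩ := (h1.and h2).exists
    intro y hy
    rw [hconst y (‖z‖⁻¹ • z) (by rw [hy, norm_smul, norm_inv, norm_norm,
      inv_mul_cancel₀ (norm_ne_zero_iff.2 hz0)])]
    exact hz
  rw [lintegral_prod_symm' _ hmF, lintegral_eq_zero_iff hmF.lintegral_prod_left']
  filter_upwards [hσ] with y hy
  exact hzero y hy

end RotationInvariant

section Averages

open scoped RealInnerProductSpace Topology ENNReal Pointwise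

variable {V : Type*} [NormedAddCommGroup V] [NormedSpace ℝ V] [FiniteDimensional ℝ V]
  [MeasurableSpace V] [BorelSpace V]

lemma exists_norm_sub_integral_le (ν : Measure V) [ν.IsAddHaarMeasure] {f : V → ℝ}
    (hf : Integrable f ν) {ε : ℝ} (hε : 0 < ε) :
    ∃ δ > (0 : ℝ), ∀ u : V, ‖u‖ ≤ δ → ∫ z, ‖f (u + z) - f z‖ ∂ν ≤ ε := by
  let f₁ : Lp ℝ 1 ν := hf.toL1 f
  have : Fact ((1 : ℝ≥0∞) ≠ ∞) := ⟨ENNReal.one_ne_top⟩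
  have hcont : Continuous fun u : V => (DomAddAct.mk u) +ᵥ f₁ :=
    DomAddAct.continuous_mk.vadd continuous_const
  have h0 : (DomAddAct.mk (0 : V)) +ᵥ f₁ = f₁ := by simp
  obtain ⟨δ, hδ, h⟩ := Metric.continuous_iff.1 hcont 0 ε hε
  refine ⟨δ / 2, by positivity, fun u hu => ?_⟩
  have h1 := h u (by rw [dist_zero_right]; linarith)
  rw [h0, dist_eq_norm, L1.norm_eq_integral_norm] at h1
  refine le_of_eq_of_le (integral_congr_ae ?_) h1.le
  have h2 : f₁ =ᵐ[ν] f := hf.coeFn_toL1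
  have h3 := (measurePreserving_add_left ν u).quasiMeasurePreserving.ae_eq h2
  filter_upwards [Lp.coeFn_sub (DomAddAct.mk u +ᵥ f₁) f₁, DomAddAct.vadd_Lp_ae_eq (DomAddAct.mk u) f₁,
    h2, h3] with z hz1 hz2 hz3 hz4
  rw [hz1, Pi.sub_apply, hz2, hz3]
  simp only [Function.comp_apply] at hz4
  simp [hz4]

/-- Absolutely continuous finite measures are almost invariant under small translations,
uniformly over all measurable sets. -/
lemma exists_measure_le_measure_translate_add (ν : Measure V) [ν.IsAddHaarMeasure] {μ : Measure V}
    [IsFiniteMeasure μ] (hμ : μ ≪ ν) {ε : ℝ} (hε : 0 < ε) :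
    ∃ δ > (0 : ℝ), ∀ u : V, ‖u‖ ≤ δ → ∀ A, MeasurableSet A →
      μ A ≤ μ {z | z + u ∈ A} + ENNReal.ofReal ε := by
  let f : V → ℝ := fun z => (μ.rnDeriv ν z).toReal
  have hf : Integrable f ν := Measure.integrable_toReal_rnDeriv
  obtain ⟨δ, hδ, h⟩ := exists_norm_sub_integral_le ν hf hε
  refine ⟨δ, hδ, fun u hu A hA => ?_⟩
  have hfu : Integrable (fun z => f (-u + z)) ν := hf.comp_add_left (-u)
  have h1 : ∫ z in A, f (-u + z) ∂ν = μ.real {z | z + u ∈ A} := by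
    have h0 := (measurePreserving_add_left ν (-u)).setIntegral_preimage_emb
      (measurableEmbedding_addLeft (-u)) f {z | z + u ∈ A}
    rw [← Measure.setIntegral_toReal_rnDeriv hμ, ← h0]
    congr 2
    ext z
    simp
  have h2 : μ.real A - μ.real {z | z + u ∈ A} ≤ ε := by
    rw [← h1, ← Measure.setIntegral_toReal_rnDeriv hμ,
      ← integral_sub hf.integrableOn hfu.integrableOn]
    refine (Real.le_norm_self _).trans ((norm_integral_le_integral_norm _).trans ?_)
    refine (setIntegral_le_integral (hf.sub hfu).norm
      (Eventually.of_forall fun z => norm_nonneg _)).trans ?_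
    refine le_of_eq_of_le (integral_congr_ae (Eventually.of_forall fun z => ?_))
      (h (-u) (by simpa using hu))
    exact norm_sub_rev _ _
  rw [← ofReal_measureReal, ← ofReal_measureReal, ← ENNReal.ofReal_add measureReal_nonneg hε.le]
  exact ENNReal.ofReal_le_ofReal (by linarith)

lemma addHaar_closedBall_inter_preimage (ν : Measure V) [ν.IsAddHaarMeasure] (E : Set V) (x : V)
    {t : ℝ} (ht : 0 < t) (δ : ℝ) :
    ν (Metric.closedBall 0 δ ∩ {u | x + t • u ∈ E}) =
      ENNReal.ofReal |(t ^ Module.finrank ℝ V)⁻¹| * ν (E ∩ Metric.closedBall x (t * δ)) := by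
  rw [← measure_preimage_add ν x (E ∩ Metric.closedBall x (t * δ)),
    ← Measure.addHaar_preimage_smul ν ht.ne']
  congr 1
  ext u
  simp only [Set.mem_inter_iff, Set.mem_ofPred_eq, Set.mem_preimage,
    mem_closedBall_iff_norm, add_sub_cancel_left, norm_smul, Real.norm_of_nonneg ht.le, sub_zero]
  rw [mul_le_mul_iff_right₀ ht, and_comm]

/-- If all large balls contain at most a proportion `a` of a set, then so do all large dilates of
an absolutely continuous probability measure, up to a small error. -/
theorem exists_dilate_measure_le (ν : Measure V) [ν.IsAddHaarMeasure] {μ : Measure V}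
    [IsProbabilityMeasure μ] (hμ : μ ≪ ν) {E : Set V} (hE : MeasurableSet E) {a : ℝ≥0∞} {r₀ : ℝ}
    (ha : ∀ r ≥ r₀, ∀ x, ν (E ∩ Metric.closedBall x r) ≤ a * ν (Metric.closedBall x r))
    {ε : ℝ} (hε : 0 < ε) :
    ∃ t₀ > (0 : ℝ), ∀ t ≥ t₀, ∀ x, μ {z | x + t • z ∈ E} ≤ a + ENNReal.ofReal ε := by
  obtain ⟨δ, hδ, h⟩ := exists_measure_le_measure_translate_add ν hμ hε
  refine ⟨max (1 : ℝ) (r₀ / δ), by positivity, fun t ht x => ?_⟩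
  have ht0 : 0 < t := lt_of_lt_of_le one_pos ((le_max_left _ _).trans ht)
  have htδ : r₀ ≤ t * δ := (div_le_iff₀ hδ).1 ((le_max_right _ _).trans ht)
  set A : Set V := {z | x + t • z ∈ E} with hA_def
  have hA : MeasurableSet A := by
    have : Measurable fun z : V => x + t • z := by fun_prop
    exact this hE
  set B : Set V := Metric.closedBall 0 δ
  have hB : MeasurableSet B := Metric.isClosed_closedBall.measurableSet
  have hB0 : ν B ≠ 0 := (Metric.measure_closedBall_pos ν _ hδ).ne'
  have hBtop : ν B ≠ ∞ := measure_closedBall_lt_top.ne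
  have hA2 : MeasurableSet {p : V × V | p.2 + p.1 ∈ A} := by
    have : Measurable fun p : V × V => p.2 + p.1 := by fun_prop
    exact this hA
  have hswap : ∫⁻ u in B, μ {z | z + u ∈ A} ∂ν = ∫⁻ z, ν (B ∩ {u | z + u ∈ A}) ∂μ := by
    have h1 := Measure.prod_apply (μ := ν.restrict B) (ν := μ) hA2
    rw [Measure.prod_apply_symm hA2] at h1
    refine h1.symm.trans (lintegral_congr fun z => ?_)
    rw [Measure.restrict_apply (measurable_prodMk_right hA2), Set.inter_comm]
    rfl
  have hball : ∀ z, ν (B ∩ {u | z + u ∈ A}) ≤ a * ν B := by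
    intro z
    have h1 : {u | z + u ∈ A} = {u | (x + t • z) + t • u ∈ E} := by
      ext u
      simp [hA_def, smul_add, add_assoc]
    have h2 := addHaar_closedBall_inter_preimage ν Set.univ (x + t • z) ht0 δ
    simp only [Set.mem_univ, Set.univ_inter, Set.ofPred_true, Set.inter_univ] at h2
    rw [h1, addHaar_closedBall_inter_preimage ν E _ ht0 δ, h2, mul_left_comm]
    gcongr
    exact ha _ htδ _
  have hle : μ A * ν B ≤ (a + ENNReal.ofReal ε) * ν B := by
    calc μ A * ν B = ∫⁻ _ in B, μ A ∂ν := by rw [setLIntegral_const]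
      _ ≤ ∫⁻ u in B, (μ {z | z + u ∈ A} + ENNReal.ofReal ε) ∂ν :=
        setLIntegral_mono' hB fun u hu => h u (by simpa [B] using hu) A hA
      _ = (∫⁻ z, ν (B ∩ {u | z + u ∈ A}) ∂μ) + ENNReal.ofReal ε * ν B := by
        rw [lintegral_add_right _ measurable_const, setLIntegral_const, hswap]
      _ ≤ (∫⁻ _, a * ν B ∂μ) + ENNReal.ofReal ε * ν B := by
        gcongr with z
        exact hball z
      _ = _ := by simp [add_mul]
  exact (ENNReal.mul_le_mul_iff_left hB0 hBtop).1 hle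

end Averages

section SphericalAverages

open scoped RealInnerProductSpace Topology ENNReal Pointwise

variable {V : Type*} [NormedAddCommGroup V] [NormedSpace ℝ V] [FiniteDimensional ℝ V]
  [MeasurableSpace V] [BorelSpace V]

/-- First moment of the averages of a set over the dilates of a probability measure on the unit
sphere. -/
lemma measure_inter_closedBall_le_lintegral_average (ν : Measure V) [ν.IsAddHaarMeasure]
    {σ : Measure V} [IsProbabilityMeasure σ] (hσ : ∀ᵐ y ∂σ, ‖y‖ = 1) {E : Set V}
    (hE : MeasurableSet E) (x₀ : V) (Q : ℝ) {t L : ℝ} (ht : 0 ≤ t) (htL : t ≤ L) :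
    ν (E ∩ Metric.closedBall x₀ Q) ≤
      ∫⁻ x in Metric.closedBall x₀ (Q + L), σ {y | x + t • y ∈ E} ∂ν := by
  have hA : MeasurableSet {p : V × V | p.1 + t • p.2 ∈ E} := by
    have : Measurable fun p : V × V => p.1 + t • p.2 := by fun_prop
    exact this hE
  have h1 := Measure.prod_apply (μ := ν.restrict (Metric.closedBall x₀ (Q + L))) (ν := σ) hA
  rw [Measure.prod_apply_symm hA] at h1
  refine le_of_le_of_eq ?_ h1
  calc ν (E ∩ Metric.closedBall x₀ Q) = ∫⁻ _, ν (E ∩ Metric.closedBall x₀ Q) ∂σ := by simp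
    _ ≤ _ := lintegral_mono_ae ?_
  filter_upwards [hσ] with y hy
  rw [Measure.restrict_apply (measurable_prodMk_right hA), ← measure_preimage_add_right ν (t • y)]
  refine measure_mono fun x hx => ⟨hx.1, ?_⟩
  have hx2 : dist (x + t • y) x₀ ≤ Q := hx.2
  have h2 : dist x (x + t • y) = t := by simp [norm_smul, hy, abs_of_nonneg ht]
  rw [Metric.mem_closedBall]
  linarith [dist_triangle x (x + t • y) x₀]

/-- Second moment of the averages of a set over the dilates of a probability measure on the unit
sphere. -/
lemma lintegral_average_sq_le (ν : Measure V) [ν.IsAddHaarMeasure]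
    {σ : Measure V} [IsProbabilityMeasure σ] (hσ : ∀ᵐ y ∂σ, ‖y‖ = 1) {E : Set V}
    (hE : MeasurableSet E) (x₀ : V) (R : ℝ) {t L : ℝ} (ht : 0 ≤ t) (htL : t ≤ L) :
    ∫⁻ x in Metric.closedBall x₀ R, σ {y | x + t • y ∈ E} ^ 2 ∂ν ≤
      ∫⁻ x in E ∩ Metric.closedBall x₀ (R + L),
        (σ.prod σ).map (fun p => p.1 - p.2) {z | x + t • z ∈ E} ∂ν := by
  have hA : MeasurableSet {p : V × (V × V) | p.1 + t • p.2.1 ∈ E ∧ p.1 + t • p.2.2 ∈ E} := by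
    have h1 : Measurable fun p : V × (V × V) => p.1 + t • p.2.1 := by fun_prop
    have h2 : Measurable fun p : V × (V × V) => p.1 + t • p.2.2 := by fun_prop
    exact (h1 hE).inter (h2 hE)
  have hB : MeasurableSet {p : V × (V × V) | p.1 + t • (p.2.1 - p.2.2) ∈ E} := by
    have h1 : Measurable fun p : V × (V × V) => p.1 + t • (p.2.1 - p.2.2) := by fun_prop
    exact h1 hE
  have hl := Measure.prod_apply (μ := ν.restrict (Metric.closedBall x₀ R)) (ν := σ.prod σ) hA
  have hr := Measure.prod_apply (μ := ν.restrict (E ∩ Metric.closedBall x₀ (R + L)))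
    (ν := σ.prod σ) hB
  rw [Measure.prod_apply_symm hA] at hl
  rw [Measure.prod_apply_symm hB] at hr
  have hl' : ∫⁻ x in Metric.closedBall x₀ R, σ {y | x + t • y ∈ E} ^ 2 ∂ν =
      ∫⁻ x in Metric.closedBall x₀ R, (σ.prod σ)
        (Prod.mk x ⁻¹' {p : V × (V × V) | p.1 + t • p.2.1 ∈ E ∧ p.1 + t • p.2.2 ∈ E}) ∂ν := by
    refine lintegral_congr fun x => ?_
    rw [sq, ← Measure.prod_prod]
    rfl
  have hr' : ∫⁻ x in E ∩ Metric.closedBall x₀ (R + L),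
        (σ.prod σ).map (fun p => p.1 - p.2) {z | x + t • z ∈ E} ∂ν =
      ∫⁻ x in E ∩ Metric.closedBall x₀ (R + L), (σ.prod σ)
        (Prod.mk x ⁻¹' {p : V × (V × V) | p.1 + t • (p.2.1 - p.2.2) ∈ E}) ∂ν := by
    refine lintegral_congr fun x => ?_
    have h1 : Measurable fun z : V => x + t • z := by fun_prop
    exact Measure.map_apply measurable_sub (h1 hE)
  rw [hl', hr', ← hl, ← hr]
  refine lintegral_mono_ae ?_
  filter_upwards [Measure.quasiMeasurePreserving_snd.ae hσ] with p hp
  rw [Measure.restrict_apply (measurable_prodMk_right hA),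
    Measure.restrict_apply (measurable_prodMk_right hB), ← measure_preimage_add_right ν (t • p.2)
      (((fun x => (x, p)) ⁻¹' {p : V × (V × V) | p.1 + t • (p.2.1 - p.2.2) ∈ E}) ∩ _)]
  refine measure_mono fun x hx => ⟨?_, hx.1.2, ?_⟩
  · have : x + t • p.2 + t • (p.1 - p.2) = x + t • p.1 := by rw [smul_sub]; abel
    simpa only [Set.mem_preimage, Set.mem_ofPred_eq, this] using hx.1.1
  · have hx2 : dist x x₀ ≤ R := hx.2
    have h2 : dist (x + t • p.2) x = t := by simp [norm_smul, hp, abs_of_nonneg ht]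
    rw [Metric.mem_closedBall]
    linarith [dist_triangle (x + t • p.2) x x₀]


lemma sq_mul_measureReal_le_variance {α : Type*} [MeasurableSpace α] {μ : Measure α}
    [IsFiniteMeasure μ] {g : α → ℝ} (hg : Measurable g) (hg0 : ∀ x, 0 ≤ g x) (hg1 : ∀ x, g x ≤ 1)
    {c ρ : ℝ} (hc : c ≤ ρ) :
    (ρ - c) ^ 2 * μ.real {x | g x ≤ c} ≤
      ∫ x, g x ^ 2 ∂μ - 2 * ρ * ∫ x, g x ∂μ + ρ ^ 2 * μ.real Set.univ := by
  have hi : Integrable g μ := Integrable.of_bound hg.aestronglyMeasurable 1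
    (Eventually.of_forall fun x => by rw [Real.norm_of_nonneg (hg0 x)]; exact hg1 x)
  have hi2 : Integrable (fun x => g x ^ 2) μ :=
    Integrable.of_bound (hg.pow_const 2).aestronglyMeasurable 1 (Eventually.of_forall fun x => by
      rw [Real.norm_of_nonneg (sq_nonneg _)]
      exact pow_le_one₀ (hg0 x) (hg1 x))
  have hexp : ∀ x, (g x - ρ) ^ 2 = g x ^ 2 - 2 * ρ * g x + ρ ^ 2 := fun x => by ring
  have hi3 : Integrable (fun x => (g x - ρ) ^ 2) μ := by
    simp only [hexp]
    exact (hi2.sub (hi.const_mul _)).add (integrable_const _)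
  have hval : ∫ x, (g x - ρ) ^ 2 ∂μ =
      ∫ x, g x ^ 2 ∂μ - 2 * ρ * ∫ x, g x ∂μ + ρ ^ 2 * μ.real Set.univ := by
    simp only [hexp]
    have hsub : Integrable (fun x => g x ^ 2 - 2 * ρ * g x) μ := hi2.sub (hi.const_mul _)
    rw [integral_add hsub (integrable_const _), integral_sub hi2 (hi.const_mul _),
      integral_const_mul, integral_const, smul_eq_mul, mul_comm (ρ ^ 2)]
  rw [← hval]
  refine le_trans ?_ (mul_meas_ge_le_integral_of_nonneg
    (Eventually.of_forall fun x => sq_nonneg (g x - ρ)) hi3 ((ρ - c) ^ 2))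
  refine mul_le_mul_of_nonneg_left (measureReal_mono fun x hx => ?_) (sq_nonneg _)
  simp only [Set.mem_ofPred_eq] at hx ⊢
  nlinarith

/-- In a ball where a set has nearly maximal density, the averages of the set over a large sphere
are rarely small. -/
lemma measureReal_average_le (ν : Measure V) [ν.IsAddHaarMeasure]
    {σ : Measure V} [IsProbabilityMeasure σ] (hσ : ∀ᵐ y ∂σ, ‖y‖ = 1) {E : Set V}
    (hE : MeasurableSet E) {x₀ : V} {Q t L ρ η c : ℝ} (ht : 0 ≤ t) (htL : t ≤ L)
    (hρ0 : 0 ≤ ρ) (hρ1 : ρ ≤ 1) (hη0 : 0 ≤ η) (hη1 : η ≤ 1) (hc : c ≤ ρ)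
    (hlower : (ρ - η) * ν.real (Metric.closedBall x₀ Q) ≤ ν.real (E ∩ Metric.closedBall x₀ Q))
    (hball : ν.real (Metric.closedBall x₀ (Q + L + L)) ≤ (1 + η) * ν.real (Metric.closedBall x₀ Q))
    (hupper : ν.real (E ∩ Metric.closedBall x₀ (Q + L + L)) ≤
      (ρ + η) * ν.real (Metric.closedBall x₀ (Q + L + L)))
    (haverage : ∀ x, (σ.prod σ).map (fun p => p.1 - p.2) {z | x + t • z ∈ E} ≤
      ENNReal.ofReal (ρ + 2 * η)) :
    (ρ - c) ^ 2 * ν.real (Metric.closedBall x₀ Q ∩ {x | σ.real {y | x + t • y ∈ E} ≤ c}) ≤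
      15 * η * ν.real (Metric.closedBall x₀ Q) := by
  set v := ν.real (Metric.closedBall x₀ Q) with hv
  have hv0 : 0 ≤ v := measureReal_nonneg
  have hfin : ∀ r, ν (Metric.closedBall x₀ r) ≠ ∞ := fun r => measure_closedBall_lt_top.ne
  set B := Metric.closedBall x₀ (Q + L)
  have : IsFiniteMeasure (ν.restrict B) := isFiniteMeasure_restrict.2 (hfin _)
  have hA : MeasurableSet {p : V × V | p.1 + t • p.2 ∈ E} := by
    have : Measurable fun p : V × V => p.1 + t • p.2 := by fun_prop
    exact this hE
  have hm : Measurable fun x => σ {y | x + t • y ∈ E} := measurable_measure_prodMk_left hA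
  have hlt : ∀ x, σ {y | x + t • y ∈ E} < ∞ := fun x => measure_lt_top _ _
  have hB : ν.real B ≤ (1 + η) * v := le_trans (measureReal_mono
    (Metric.closedBall_subset_closedBall (by linarith)) (hfin _)) hball
  have hfirst : (ρ - η) * v ≤ ∫ x in B, σ.real {y | x + t • y ∈ E} ∂ν := by
    refine hlower.trans ?_
    simp only [measureReal_def]
    rw [integral_toReal hm.aemeasurable (Eventually.of_forall hlt)]
    refine ENNReal.toReal_mono ?_
      (measure_inter_closedBall_le_lintegral_average ν hσ hE x₀ Q ht htL)
    refine ((lintegral_mono fun x => prob_le_one).trans_lt ?_).ne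
    rw [lintegral_const, one_mul]
    exact measure_lt_top _ _
  have hsecond : ∫ x in B, σ.real {y | x + t • y ∈ E} ^ 2 ∂ν ≤
      (ρ + 2 * η) * ((ρ + η) * ((1 + η) * v)) := by
    have h1 : ∫⁻ x in B, σ {y | x + t • y ∈ E} ^ 2 ∂ν ≤
        ENNReal.ofReal (ρ + 2 * η) * ν (E ∩ Metric.closedBall x₀ (Q + L + L)) := by
      refine (lintegral_average_sq_le ν hσ hE x₀ (Q + L) ht htL).trans ?_
      rw [← setLIntegral_const]
      exact lintegral_mono haverage
    have h2 : ν (E ∩ Metric.closedBall x₀ (Q + L + L)) ≠ ∞ :=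
      measure_ne_top_of_subset Set.inter_subset_right (hfin _)
    simp only [measureReal_def, ← ENNReal.toReal_pow]
    rw [integral_toReal (hm.pow_const 2).aemeasurable
      (Eventually.of_forall fun x => ENNReal.pow_lt_top (hlt x))]
    refine (ENNReal.toReal_mono (ENNReal.mul_ne_top ENNReal.ofReal_ne_top h2) h1).trans ?_
    rw [ENNReal.toReal_mul, ENNReal.toReal_ofReal (by positivity), ← measureReal_def]
    gcongr
    exact hupper.trans (by gcongr)
  have hcheb := sq_mul_measureReal_le_variance (μ := ν.restrict B) (g := fun x =>
    σ.real {y | x + t • y ∈ E}) hm.ennreal_toReal (fun x => measureReal_nonneg)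
    (fun x => measureReal_le_one) hc
  have hbad : MeasurableSet {x | σ.real {y | x + t • y ∈ E} ≤ c} :=
    measurableSet_le hm.ennreal_toReal measurable_const
  rw [measureReal_restrict_apply_univ, measureReal_restrict_apply hbad] at hcheb
  have hmono : ν.real (Metric.closedBall x₀ Q ∩ {x | σ.real {y | x + t • y ∈ E} ≤ c}) ≤
      ν.real ({x | σ.real {y | x + t • y ∈ E} ≤ c} ∩ B) :=
    measureReal_mono (fun x hx => ⟨hx.2, Metric.closedBall_subset_closedBall (by linarith) hx.1⟩)
      (measure_ne_top_of_subset Set.inter_subset_right (hfin _))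
  have hpoly : (ρ + 2 * η) * ((ρ + η) * (1 + η)) - 2 * ρ * (ρ - η) + ρ ^ 2 * (1 + η) ≤ 15 * η := by
    have h1 : ρ * η ≤ η := mul_le_of_le_one_left hη0 hρ1
    have h2 : η * η ≤ η := mul_le_of_le_one_left hη0 hη1
    have h3 : ρ * (ρ * η) ≤ η := (mul_le_of_le_one_left (by positivity) hρ1).trans h1
    have h4 : ρ * (η * η) ≤ η := (mul_le_of_le_one_left (by positivity) hρ1).trans h2
    have h5 : η * (η * η) ≤ η := (mul_le_of_le_one_left (by positivity) hη1).trans h2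
    nlinarith
  have h1 := mul_le_mul_of_nonneg_right hpoly hv0
  have h2 := mul_le_mul_of_nonneg_left hfirst (by positivity : 0 ≤ 2 * ρ)
  have h3 := mul_le_mul_of_nonneg_left hB (sq_nonneg ρ)
  have h4 := mul_le_mul_of_nonneg_left hmono (sq_nonneg (ρ - c))
  linarith

/-- In a ball where a set has nearly maximal density, some point of the set has large averages over
any given finite family of large spheres. -/
lemma exists_forall_lt_average (ν : Measure V) [ν.IsAddHaarMeasure]
    {σ : Measure V} [IsProbabilityMeasure σ] (hσ : ∀ᵐ y ∂σ, ‖y‖ = 1) {E : Set V}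
    (hE : MeasurableSet E) {m : ℕ} {x₀ : V} {Q L ρ η c : ℝ} {t : Fin m → ℝ}
    (ht : ∀ i, 0 ≤ t i) (htL : ∀ i, t i ≤ L) (hQ : 0 < Q)
    (hρ0 : 0 ≤ ρ) (hρ1 : ρ ≤ 1) (hη0 : 0 ≤ η) (hη1 : η ≤ 1) (hc : c < ρ)
    (hη : 15 * η * m < (ρ - c) ^ 2 * (ρ - η))
    (hlower : (ρ - η) * ν.real (Metric.closedBall x₀ Q) ≤ ν.real (E ∩ Metric.closedBall x₀ Q))
    (hball : ν.real (Metric.closedBall x₀ (Q + L + L)) ≤ (1 + η) * ν.real (Metric.closedBall x₀ Q))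
    (hupper : ν.real (E ∩ Metric.closedBall x₀ (Q + L + L)) ≤
      (ρ + η) * ν.real (Metric.closedBall x₀ (Q + L + L)))
    (haverage : ∀ i x, (σ.prod σ).map (fun p => p.1 - p.2) {z | x + t i • z ∈ E} ≤
      ENNReal.ofReal (ρ + 2 * η)) :
    ∃ x ∈ E, ∀ i, c < σ.real {y | x + t i • y ∈ E} := by
  by_contra! hcon
  set v := ν.real (Metric.closedBall x₀ Q) with hv
  have hv0 : 0 < v := ENNReal.toReal_pos (Metric.measure_closedBall_pos ν _ hQ).ne'
    measure_closedBall_lt_top.ne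
  have hsub : E ∩ Metric.closedBall x₀ Q ⊆
      ⋃ i, Metric.closedBall x₀ Q ∩ {x | σ.real {y | x + t i • y ∈ E} ≤ c} := by
    intro x hx
    obtain ⟨i, hi⟩ := hcon x hx.1
    exact Set.mem_iUnion.2 ⟨i, hx.2, hi⟩
  have hle : ν.real (E ∩ Metric.closedBall x₀ Q) ≤
      ∑ i, ν.real (Metric.closedBall x₀ Q ∩ {x | σ.real {y | x + t i • y ∈ E} ≤ c}) :=
    (measureReal_mono hsub (measure_ne_top_of_subset
      (Set.iUnion_subset fun i => Set.inter_subset_left) measure_closedBall_lt_top.ne)).trans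
      (measureReal_iUnion_fintype_le _)
  have h1 : (ρ - c) ^ 2 * ((ρ - η) * v) ≤ ∑ _i : Fin m, 15 * η * v := by
    refine (mul_le_mul_of_nonneg_left (hlower.trans hle) (sq_nonneg _)).trans ?_
    rw [Finset.mul_sum]
    exact Finset.sum_le_sum fun i _ => measureReal_average_le ν hσ hE (ht i) (htL i) hρ0 hρ1 hη0 hη1
      hc.le hlower hball hupper (haverage i)
  rw [Finset.sum_const, Finset.card_univ, Fintype.card_fin, nsmul_eq_mul] at h1
  nlinarith [mul_lt_mul_of_pos_right hη hv0]

end SphericalAverages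

section UpperBanachDensity

open scoped Topology

lemma upperBanachDensity_le_one (d : ℕ) (E : Set (EuclideanSpace ℝ (Fin d))) :
    upperBanachDensity d E ≤ 1 := by
  refine limsup_le_of_le (by isBoundedDefault) (Eventually.of_forall fun r => iSup_le fun x => ?_)
  exact ENNReal.div_le_of_le_mul (by rw [one_mul]; exact measure_mono Set.inter_subset_right)

lemma exists_forall_volume_inter_closedBall_le {d : ℕ} {E : Set (EuclideanSpace ℝ (Fin d))}
    {a : ENNReal} (ha : upperBanachDensity d E < a) :
    ∃ r₀ > (0 : ℝ), ∀ r ≥ r₀, ∀ x,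
      volume (E ∩ Metric.closedBall x r) ≤ a * volume (Metric.closedBall x r) := by
  obtain ⟨r₀, hr₀⟩ := eventually_atTop.1 (eventually_lt_of_limsup_lt ha)
  refine ⟨max r₀ 1, by positivity, fun r hr x => ?_⟩
  have hpos : 0 < r := one_pos.trans_le ((le_max_right _ _).trans hr)
  rw [← ENNReal.div_le_iff (Metric.measure_closedBall_pos volume x hpos).ne'
    measure_closedBall_lt_top.ne]
  exact (le_iSup (fun x => volume (E ∩ Metric.closedBall x r) / volume (Metric.closedBall x r))
    x).trans (hr₀ r ((le_max_left _ _).trans hr)).le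

lemma frequently_exists_le_volume_inter_closedBall {d : ℕ} {E : Set (EuclideanSpace ℝ (Fin d))}
    {b : ENNReal} (hb : b < upperBanachDensity d E) :
    ∃ᶠ r : ℝ in atTop, ∃ x,
      b * volume (Metric.closedBall x r) ≤ volume (E ∩ Metric.closedBall x r) := by
  refine (frequently_lt_of_lt_limsup (by isBoundedDefault) hb).mono fun r hr => ?_
  obtain ⟨x, hx⟩ := lt_iSup_iff.1 hr
  exact ⟨x, ENNReal.mul_le_of_le_div hx.le⟩

lemma eventually_volume_closedBall_add_le (d : ℕ) (L : ℝ) {η : ℝ} (hη : 0 < η) :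
    ∀ᶠ r : ℝ in atTop, ∀ x : EuclideanSpace ℝ (Fin d),
      volume.real (Metric.closedBall x (r + L)) ≤
        (1 + η) * volume.real (Metric.closedBall x r) := by
  have hlim : Tendsto (fun r : ℝ => (1 + L / r) ^ d) atTop (𝓝 1) := by
    simpa using ((tendsto_const_nhds (x := L).div_atTop tendsto_id).const_add 1).pow d
  filter_upwards [hlim.eventually_le_const (by linarith : (1 : ℝ) < 1 + η), eventually_gt_atTop 0,
    eventually_ge_atTop (-L)] with r hr hr0 hrL x
  rw [Measure.addHaar_real_closedBall' volume x hr0.le,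
    Measure.addHaar_real_closedBall' volume x (by linarith), finrank_euclideanSpace_fin, ← mul_assoc]
  gcongr
  calc (r + L) ^ d = (1 + L / r) ^ d * r ^ d := by rw [← mul_pow]; field_simp
    _ ≤ _ := by gcongr

end UpperBanachDensity

section SphereMeasure

variable {V : Type*} [NormedAddCommGroup V] [InnerProductSpace ℝ V] [FiniteDimensional ℝ V]
  [MeasurableSpace V] [BorelSpace V]

/-- The normalized surface measure of the unit sphere. -/
noncomputable def unitSphereMeasure (V : Type*) [NormedAddCommGroup V] [InnerProductSpace ℝ V]
    [MeasurableSpace V] [BorelSpace V] (s : ℝ) : Measure V :=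
  ProbabilityTheory.cond μH[s] (Metric.sphere (0 : V) 1)

omit [FiniteDimensional ℝ V] in
lemma ae_norm_eq_one_unitSphereMeasure (s : ℝ) : ∀ᵐ y ∂unitSphereMeasure V s, ‖y‖ = 1 := by
  filter_upwards [ProbabilityTheory.ae_cond_mem (μ := μH[s])
    (Metric.isClosed_sphere (x := (0 : V)) (ε := 1)).measurableSet] with y hy
  simpa using hy

lemma isProbabilityMeasure_unitSphereMeasure {n : ℕ} (hn : Module.finrank ℝ V = n + 1) :
    IsProbabilityMeasure (unitSphereMeasure V n) :=
  ProbabilityTheory.cond_isProbabilityMeasure_of_finite (hausdorffMeasure_sphere_pos hn).ne'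
    (hausdorffMeasure_sphere_lt_top hn).ne

omit [FiniteDimensional ℝ V] in
lemma map_unitSphereMeasure (s : ℝ) (g : V ≃ₗᵢ[ℝ] V) :
    (unitSphereMeasure V s).map g = unitSphereMeasure V s := by
  rw [unitSphereMeasure, ProbabilityTheory.cond, Measure.map_smul,
    map_hausdorffMeasure_restrict_sphere]

lemma lt_hausdorffMeasure_inter_sphere {n : ℕ} (hn : Module.finrank ℝ V = n + 1) {E : Set V}
    {x : V} {t c : ℝ} (hc : 0 ≤ c) (ht : 0 < t)
    (h : c < (unitSphereMeasure V n).real {y | x + t • y ∈ E}) :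
    ENNReal.ofReal c * μH[(n : ℝ)] (Metric.sphere (0 : V) t) <
      μH[(n : ℝ)] (E ∩ Metric.sphere x t) := by
  have := isProbabilityMeasure_unitSphereMeasure hn
  have hpos := hausdorffMeasure_sphere_pos hn
  have htop := hausdorffMeasure_sphere_lt_top hn
  have hsphere := hausdorffMeasure_inter_sphere n.cast_nonneg Set.univ (0 : V) ht
  simp only [Set.univ_inter, Set.mem_univ, Set.ofPred_true, Set.inter_univ] at hsphere
  have h1 : ENNReal.ofReal c < unitSphereMeasure V n {y | x + t • y ∈ E} := by
    rwa [ENNReal.ofReal_lt_iff_lt_toReal hc (measure_ne_top _ _)]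
  rw [unitSphereMeasure, ProbabilityTheory.cond_apply
    (Metric.isClosed_sphere (x := (0 : V)) (ε := 1)).measurableSet, mul_comm, ← div_eq_mul_inv,
    ENNReal.lt_div_iff_mul_lt (Or.inl hpos.ne') (Or.inl htop.ne)] at h1
  rw [hsphere, hausdorffMeasure_inter_sphere n.cast_nonneg E x ht, mul_left_comm]
  have ht' : ENNReal.ofReal t ≠ 0 := (ENNReal.ofReal_pos.2 ht).ne'
  exact (ENNReal.mul_lt_mul_iff_right (ENNReal.rpow_pos (ENNReal.ofReal_pos.2 ht)
    ENNReal.ofReal_ne_top).ne' (ENNReal.rpow_ne_top_of_nonneg n.cast_nonneg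
    ENNReal.ofReal_ne_top)).2 h1

end SphereMeasure

/-- If `E ⊆ ℝ^d` (`d ≥ 2`) is measurable with `0 < ρ' < ρ(E)` and `0 < S ≤ D`, then there is
`s₀ > 0` such that for all radii `r₁, …, r_m ∈ [S, D]` and all `s ≥ s₀` there exists `x ∈ E`
with `𝓗^{d-1}(E ∩ S_{rᵢ s}(x)) > ρ' · 𝓗^{d-1}(S_{rᵢ s})` for every `i`. -/
theorem concentric_spheres (d : ℕ) (hd : 2 ≤ d)
    (E : Set (EuclideanSpace ℝ (Fin d))) (hE : MeasurableSet E)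
    (ρ' : ℝ) (hρ'pos : 0 < ρ') (hρ' : ENNReal.ofReal ρ' < upperBanachDensity d E)
    (S D : ℝ) (hS : 0 < S) (hSD : S ≤ D) (m : ℕ) (hm : 0 < m) :
    ∃ s₀ > (0 : ℝ), ∀ r : Fin m → ℝ, (∀ i, r i ∈ Set.Icc S D) → ∀ s : ℝ, s₀ ≤ s →
      ∃ x ∈ E, ∀ i,
        ENNReal.ofReal ρ' *
            μH[(d : ℝ) - 1] (Metric.sphere (0 : EuclideanSpace ℝ (Fin d)) (r i * s)) <
          μH[(d : ℝ) - 1] (E ∩ Metric.sphere x (r i * s)) := by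
  obtain ⟨n, rfl⟩ : ∃ n, d = n + 1 := ⟨d - 1, by omega⟩
  have hn : Module.finrank ℝ (EuclideanSpace ℝ (Fin (n + 1))) = n + 1 :=
    finrank_euclideanSpace_fin
  have hexp : ((n + 1 : ℕ) : ℝ) - 1 = n := by push_cast; ring
  rw [hexp]
  have hprob := isProbabilityMeasure_unitSphereMeasure hn
  set σ := unitSphereMeasure (EuclideanSpace ℝ (Fin (n + 1))) n
  have hσ : ∀ᵐ y ∂σ, ‖y‖ = 1 := ae_norm_eq_one_unitSphereMeasure _
  obtain ⟨ρ, hρ⟩ : ∃ ρ, ρ = (upperBanachDensity (n + 1) E).toReal := ⟨_, rfl⟩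
  have hρE : upperBanachDensity (n + 1) E = ENNReal.ofReal ρ := by
    rw [hρ, ENNReal.ofReal_toReal
      (ne_top_of_le_ne_top ENNReal.one_ne_top (upperBanachDensity_le_one _ _))]
  have hρ1 : ρ ≤ 1 := by
    have := upperBanachDensity_le_one (n + 1) E
    rwa [hρE, ENNReal.ofReal_le_one] at this
  have hlt : ρ' < ρ := by
    rw [hρE] at hρ'
    exact (ENNReal.ofReal_lt_ofReal_iff_of_nonneg hρ'pos.le).1 hρ'
  have hρ0 : 0 < ρ := hρ'pos.trans hlt
  obtain ⟨η, hη0, hη1, hηρ, hη⟩ : ∃ η : ℝ, 0 < η ∧ η ≤ 1 ∧ η < ρ ∧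
      15 * η * m < (ρ - ρ') ^ 2 * (ρ - η) := by
    have h1 : Tendsto (fun η : ℝ => 15 * η * m) (nhdsWithin 0 (Set.Ioi 0)) (nhds (15 * 0 * m)) :=
      tendsto_nhdsWithin_of_tendsto_nhds (Continuous.tendsto (by fun_prop) 0)
    have h2 : Tendsto (fun η : ℝ => (ρ - ρ') ^ 2 * (ρ - η)) (nhdsWithin 0 (Set.Ioi 0))
        (nhds ((ρ - ρ') ^ 2 * (ρ - 0))) :=
      tendsto_nhdsWithin_of_tendsto_nhds (Continuous.tendsto (by fun_prop) 0)
    have h3 : 15 * 0 * (m : ℝ) < (ρ - ρ') ^ 2 * (ρ - 0) := by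
      have := sub_pos.2 hlt
      simp only [mul_zero, zero_mul, sub_zero]
      positivity
    have h4 : Set.Ioo (0 : ℝ) (min 1 ρ) ∈ nhdsWithin 0 (Set.Ioi 0) :=
      Ioo_mem_nhdsGT (by positivity)
    obtain ⟨η, h, hη0, hη⟩ := ((h1.eventually_lt h2 h3).and h4).exists
    exact ⟨η, hη0, (hη.trans_le (min_le_left _ _)).le, hη.trans_le (min_le_right _ _), h⟩
  obtain ⟨r₀, -, hr₀⟩ := exists_forall_volume_inter_closedBall_le
    (E := E) (a := ENNReal.ofReal (ρ + η))
    (by rw [hρE]; exact (ENNReal.ofReal_lt_ofReal_iff (by positivity)).2 (by linarith))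
  have hac := map_sub_prod_absolutelyContinuous (by rw [hn]; exact hd) hσ
    fun g => map_unitSphereMeasure _ g
  have : IsProbabilityMeasure ((σ.prod σ).map fun p => p.1 - p.2) :=
    Measure.isProbabilityMeasure_map measurable_sub.aemeasurable
  obtain ⟨t₀, ht₀, haverage⟩ := exists_dilate_measure_le volume hac hE hr₀ hη0
  refine ⟨t₀ / S, by positivity, fun r hr s hs => ?_⟩
  have hs0 : 0 < s := lt_of_lt_of_le (by positivity) hs
  have hrs : ∀ i, t₀ ≤ r i * s := fun i => calc
    t₀ ≤ s * S := (div_le_iff₀ hS).1 hs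
    _ ≤ r i * s := by rw [mul_comm]; exact mul_le_mul_of_nonneg_right (hr i).1 hs0.le
  obtain ⟨Q, ⟨x₀, hx₀⟩, ⟨hvol, hQ0⟩, hQr₀⟩ := ((frequently_exists_le_volume_inter_closedBall
    (E := E) (b := ENNReal.ofReal (ρ - η)) (by
      rw [hρE]; exact (ENNReal.ofReal_lt_ofReal_iff hρ0).2 (by linarith))).and_eventually
    (((eventually_volume_closedBall_add_le (n + 1) (D * s + D * s) hη0).and
      (eventually_gt_atTop 0)).and (eventually_ge_atTop r₀))).exists
  have hDs : 0 < D * s := mul_pos (hS.trans_le hSD) hs0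
  have hball := hvol x₀
  rw [← add_assoc] at hball
  have hupper := hr₀ (Q + D * s + D * s) (by linarith) x₀
  obtain ⟨x, hxE, hx⟩ := exists_forall_lt_average volume hσ hE (t := fun i => r i * s)
    (fun i => ht₀.le.trans (hrs i)) (fun i => mul_le_mul_of_nonneg_right (hr i).2 hs0.le)
    hQ0 hρ0.le hρ1 hη0.le hη1 hlt hη
    (by
      have := ENNReal.toReal_mono
        (measure_ne_top_of_subset Set.inter_subset_right measure_closedBall_lt_top.ne) hx₀
      rwa [ENNReal.toReal_mul, ENNReal.toReal_ofReal (by linarith)] at this)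
    hball
    (by
      have := ENNReal.toReal_mono
        (ENNReal.mul_ne_top ENNReal.ofReal_ne_top measure_closedBall_lt_top.ne) hupper
      rwa [ENNReal.toReal_mul, ENNReal.toReal_ofReal (by linarith)] at this)
    (fun i x => (haverage _ (hrs i) x).trans_eq (by
      rw [← ENNReal.ofReal_add (by linarith) hη0.le]
      congr 1
      ring))
  exact ⟨x, hxE, fun i =>
    lt_hausdorffMeasure_inter_sphere hn hρ'pos.le (ht₀.trans_le (hrs i)) (hx i)⟩
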